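/- arXiv:1506.07404 — 3 statements merged into one kernel-verified Lean document; each statement's English description precedes it below -/
import Mathlib

section
/- Let 0 < β < 2, α₀ > 0 and K > 0, and let h : ℝ → [0,∞) be a measurable function with h(x) ≤ K·|x|^{−(1+β)} for all 0 < |x| ≤ α₀. Then there exists a constant K' > 0 such that for all real numbers a, b with 0 < 2a ≤ b ≤ α₀: ∫∫ 1_{|u−z| ≤ a}·1_{b/2 < |u| ≤ α₀}·1_{b/2 < |z| ≤ α₀}·h(u)·h(z) dz du ≤ K'·a·b^{−(1+3β)}. -/
open MeasureTheory

theorem lintegral_abs_rpow_tail {s c : ℝ} (hs : s < -1) (hc : 0 < c) :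
    (∫⁻ u : ℝ, {u : ℝ | c < |u|}.indicator (fun u => ENNReal.ofReal (|u| ^ s)) u)
      ≤ 2 * ENNReal.ofReal (-c ^ (s + 1) / (s + 1)) := by
  set g : ℝ → ENNReal := (Set.Ioi c).indicator fun u => ENNReal.ofReal (u ^ s) with hg
  have hgm : Measurable g := by
    refine Measurable.indicator ?_ measurableSet_Ioi
    fun_prop
  have hgi : ∫⁻ u, g u = ENNReal.ofReal (-c ^ (s + 1) / (s + 1)) := by
    rw [hg, lintegral_indicator measurableSet_Ioi, ← integral_Ioi_rpow_of_lt hs hc,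
      ofReal_integral_eq_lintegral_ofReal (integrableOn_Ioi_rpow_of_lt hs hc)]
    filter_upwards [ae_restrict_mem measurableSet_Ioi] with x hx
    exact Real.rpow_nonneg (hc.trans hx).le _
  calc (∫⁻ u : ℝ, {u : ℝ | c < |u|}.indicator (fun u => ENNReal.ofReal (|u| ^ s)) u)
      ≤ ∫⁻ u, (g u + g (-u)) := by
        refine lintegral_mono fun u => Set.indicator_le' (g := fun u => g u + g (-u)) ?_ ?_ u
        · intro u hu
          rcases lt_abs.1 (Set.mem_ofPred.1 hu) with h | h
          · simp [hg, h, abs_of_pos (hc.trans h)]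
          · have : c < -u := h
            simp [hg, this, abs_of_neg (neg_pos.1 (hc.trans h))]
        · intro u _
          exact zero_le
    _ = 2 * ENNReal.ofReal (-c ^ (s + 1) / (s + 1)) := by
        rw [lintegral_add_left hgm, lintegral_neg_eq_self, hgi, two_mul]

theorem small_jump_coincidence_bound
    (β α₀ K : ℝ) (hβ0 : 0 < β) (hβ2 : β < 2) (hα₀ : 0 < α₀) (hK : 0 < K)
    (h : ℝ → ℝ) (hmeas : Measurable h) (hnonneg : ∀ x, 0 ≤ h x)
    (hbound : ∀ x : ℝ, 0 < |x| → |x| ≤ α₀ → h x ≤ K * |x| ^ (-(1 + β))) :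
    ∃ K' : ℝ, 0 < K' ∧ ∀ a b : ℝ, 0 < a → 2 * a ≤ b → b ≤ α₀ →
      (∫⁻ u : ℝ, ∫⁻ z : ℝ,
          (if |u - z| ≤ a ∧ b / 2 < |u| ∧ |u| ≤ α₀ ∧ b / 2 < |z| ∧ |z| ≤ α₀
            then ENNReal.ofReal (h u * h z) else 0))
        ≤ ENNReal.ofReal (K' * a * b ^ (-(1 + 3 * β))) := by
  refine ⟨4 * K ^ 2 / β * α₀ ^ β * 2 ^ (1 + 3 * β), by positivity, ?_⟩
  intro a b ha hab hb
  obtain ⟨c, hc⟩ : ∃ c, c = b / 2 := ⟨_, rfl⟩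
  have hc0 : 0 < c := by linarith
  have hcα : c ≤ α₀ := by linarith
  rw [← hc]
  set F : ℝ → ENNReal :=
    {u : ℝ | c < |u|}.indicator fun u => ENNReal.ofReal (|u| ^ (-(1 + β))) with hF
  set M : ℝ := K ^ 2 * c ^ (-(1 + β)) with hM
  have hM0 : 0 ≤ M := by positivity
  have inner (u : ℝ) : (∫⁻ z : ℝ,
      (if |u - z| ≤ a ∧ c < |u| ∧ |u| ≤ α₀ ∧ c < |z| ∧ |z| ≤ α₀
        then ENNReal.ofReal (h u * h z) else 0))
      ≤ ENNReal.ofReal (M * (2 * a)) * F u := by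
    calc _ ≤ ∫⁻ z : ℝ, (Set.Icc (u - a) (u + a)).indicator
            (fun _ => ENNReal.ofReal M * F u) z := by
          refine lintegral_mono fun z => ?_
          dsimp only
          split_ifs with hz
          · obtain ⟨hz1, hu1, hu2, hz2, hz3⟩ := hz
            have hmem : z ∈ Set.Icc (u - a) (u + a) := by
              rw [abs_le] at hz1
              constructor <;> linarith
            have hFu : F u = ENNReal.ofReal (|u| ^ (-(1 + β))) :=
              Set.indicator_of_mem (s := {u : ℝ | c < |u|}) hu1 _
            rw [Set.indicator_of_mem hmem, hFu, ← ENNReal.ofReal_mul hM0]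
            refine ENNReal.ofReal_le_ofReal ?_
            have hzle : h z ≤ K * c ^ (-(1 + β)) :=
              (hbound z (hc0.trans hz2) hz3).trans <| mul_le_mul_of_nonneg_left
                (Real.rpow_le_rpow_of_nonpos hc0 hz2.le (by linarith)) hK.le
            calc h u * h z ≤ (K * |u| ^ (-(1 + β))) * (K * c ^ (-(1 + β))) :=
                  mul_le_mul (hbound u (hc0.trans hu1) hu2) hzle (hnonneg z) (by positivity)
              _ = M * |u| ^ (-(1 + β)) := by rw [hM]; ring
          · exact zero_le
      _ = ENNReal.ofReal (M * (2 * a)) * F u := by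
          rw [lintegral_indicator_const measurableSet_Icc, Real.volume_Icc,
            ENNReal.ofReal_mul hM0, show u + a - (u - a) = 2 * a by ring]
          ring
  refine (lintegral_mono inner).trans ?_
  rw [lintegral_const_mul' _ _ ENNReal.ofReal_ne_top]
  refine (mul_le_mul_right (lintegral_abs_rpow_tail (by linarith) hc0) _).trans ?_
  rw [show (2 : ENNReal) = ENNReal.ofReal 2 by simp, ← ENNReal.ofReal_mul (by norm_num),
    ← ENNReal.ofReal_mul (by positivity)]
  refine ENNReal.ofReal_le_ofReal ?_
  have hb2 : b = 2 * c := by linarith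
  have hs : -(1 + β) + 1 = -β := by ring
  have hp : c ^ (-(1 + β)) * c ^ (-β) = c ^ (-(1 + 3 * β)) * c ^ β := by
    rw [← Real.rpow_add hc0, ← Real.rpow_add hc0]
    ring_nf
  have h2 : (2 : ℝ) ^ (1 + 3 * β) * 2 ^ (-(1 + 3 * β)) = 1 := by
    rw [← Real.rpow_add two_pos]
    simp
  calc M * (2 * a) * (2 * (-c ^ (-(1 + β) + 1) / (-(1 + β) + 1)))
      = 4 * K ^ 2 / β * a * (c ^ (-(1 + β)) * c ^ (-β)) := by
        rw [hs, hM, neg_div_neg_eq]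
        ring
    _ = 4 * K ^ 2 / β * a * c ^ (-(1 + 3 * β)) * c ^ β := by rw [hp]; ring
    _ ≤ 4 * K ^ 2 / β * a * c ^ (-(1 + 3 * β)) * α₀ ^ β := by gcongr
    _ = 4 * K ^ 2 / β * a * c ^ (-(1 + 3 * β)) * α₀ ^ β *
          (2 ^ (1 + 3 * β) * 2 ^ (-(1 + 3 * β))) := by rw [h2, mul_one]
    _ = 4 * K ^ 2 / β * α₀ ^ β * 2 ^ (1 + 3 * β) * a * b ^ (-(1 + 3 * β)) := by
        rw [hb2, Real.mul_rpow zero_le_two hc0.le]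
        ring
end

section
/- Let K > 0 and M ≥ 1, and let h : ℝ → [0,∞) be a measurable function such that h is bounded on each set {x : 1/n ≤ |x| ≤ n} for every n ∈ ℕ and h(x) ≤ K·|x|^{−4} for all |x| ≥ M. Then for every α > 0 there exists a constant K(α) > 0 such that for all 0 < a ≤ 1: ∫∫ 1_{|u−z| ≤ a}·1_{|u| > α}·1_{|z| > α}·h(u)·h(z) dz du ≤ K(α)·a. -/
open MeasureTheory

/-- Away from the origin, a function that is bounded on annuli and has a tail of order `|x| ^ (-4)`
is dominated by a multiple of `(1 + x ^ 2)⁻¹`. -/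
lemma exists_le_mul_inv_one_add_sq
    {K M : ℝ} (hK : 0 < K) (hM : 1 ≤ M) {h : ℝ → ℝ}
    (hmid : ∀ n : ℕ, ∃ B : ℝ, ∀ x : ℝ, 1 / (n : ℝ) ≤ |x| → |x| ≤ (n : ℝ) → h x ≤ B)
    (htail : ∀ x : ℝ, M ≤ |x| → h x ≤ K * |x| ^ (-(4 : ℝ))) {α : ℝ} (hα : 0 < α) :
    ∃ C : ℝ, 0 < C ∧ ∀ x : ℝ, α < |x| → h x ≤ C * (1 + x ^ 2)⁻¹ := by
  obtain ⟨n, hn⟩ := exists_nat_ge (max (1 / α) M)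
  obtain ⟨B, hB⟩ := hmid n
  have hnM : M ≤ n := (le_max_right _ _).trans hn
  have hnα : 1 / (n : ℝ) ≤ α :=
    (one_div_le hα (by linarith)).1 ((le_max_left _ _).trans hn)
  refine ⟨|B| * (1 + (n : ℝ) ^ 2) + 2 * K, by positivity, fun x hx ↦ ?_⟩
  have hpos : 0 < 1 + x ^ 2 := by positivity
  rw [← div_eq_mul_inv, le_div_iff₀ hpos]
  rcases le_total |x| n with hxn | hxn
  · have hxB : h x ≤ |B| := (hB x (hnα.trans hx.le) hxn).trans (le_abs_self B)
    have hsq : 1 + x ^ 2 ≤ 1 + (n : ℝ) ^ 2 := by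
      rw [← sq_abs x]; gcongr
    calc h x * (1 + x ^ 2) ≤ |B| * (1 + (n : ℝ) ^ 2) := by gcongr
      _ ≤ _ := by linarith
  · have hx1 : 1 ≤ x ^ 2 := by
      rw [← sq_abs x]
      exact one_le_pow₀ (by linarith)
    have hpow : |x| ^ (-(4 : ℝ)) = (x ^ 4)⁻¹ := by
      rw [Real.rpow_neg (abs_nonneg x), ← Even.pow_abs (by decide : Even 4)]
      norm_cast
    have hle : (x ^ 4)⁻¹ * (1 + x ^ 2) ≤ 2 := by
      rw [inv_mul_le_iff₀ (by nlinarith)]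
      nlinarith
    calc h x * (1 + x ^ 2) ≤ K * (x ^ 4)⁻¹ * (1 + x ^ 2) := by
          gcongr
          exact hpow ▸ htail x (hnM.trans hxn)
      _ = K * ((x ^ 4)⁻¹ * (1 + x ^ 2)) := by ring
      _ ≤ K * 2 := by gcongr
      _ ≤ _ := by nlinarith [mul_nonneg (abs_nonneg B) (by positivity : 0 ≤ 1 + (n : ℝ) ^ 2)]

theorem large_jump_coincidence_bound
    (K M : ℝ) (hK : 0 < K) (hM : 1 ≤ M)
    (h : ℝ → ℝ) (hmeas : Measurable h) (hnonneg : ∀ x, 0 ≤ h x)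
    (hmid : ∀ n : ℕ, ∃ B : ℝ, ∀ x : ℝ, 1 / (n : ℝ) ≤ |x| → |x| ≤ (n : ℝ) → h x ≤ B)
    (htail : ∀ x : ℝ, M ≤ |x| → h x ≤ K * |x| ^ (-(4 : ℝ))) :
    ∀ α : ℝ, 0 < α → ∃ Kα : ℝ, 0 < Kα ∧ ∀ a : ℝ, 0 < a → a ≤ 1 →
      (∫⁻ u : ℝ, ∫⁻ z : ℝ,
          (if |u - z| ≤ a ∧ α < |u| ∧ α < |z| then ENNReal.ofReal (h u * h z) else 0))
        ≤ ENNReal.ofReal (Kα * a) := by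
  intro α hα
  obtain ⟨C, hC, hbound⟩ := exists_le_mul_inv_one_add_sq hK hM hmid htail hα
  refine ⟨2 * C ^ 2 * Real.pi, by positivity, fun a ha _ ↦ ?_⟩
  have hpointwise (u z : ℝ) :
      (if |u - z| ≤ a ∧ α < |u| ∧ α < |z| then ENNReal.ofReal (h u * h z) else 0) ≤
        (Metric.closedBall u a).indicator
          (fun _ ↦ ENNReal.ofReal (C ^ 2 * (1 + u ^ 2)⁻¹)) z := by
    split_ifs with huz
    · obtain ⟨hdist, hu, hz⟩ := huz
      have hmem : z ∈ Metric.closedBall u a := by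
        rwa [Metric.mem_closedBall, dist_comm, Real.dist_eq]
      rw [Set.indicator_of_mem hmem]
      apply ENNReal.ofReal_le_ofReal
      have hzC : h z ≤ C := (hbound z hz).trans
        (mul_le_of_le_one_right hC.le (inv_le_one_of_one_le₀ (by nlinarith)))
      calc h u * h z ≤ C * (1 + u ^ 2)⁻¹ * C :=
            mul_le_mul (hbound u hu) hzC (hnonneg z) (by positivity)
        _ = C ^ 2 * (1 + u ^ 2)⁻¹ := by ring
    · exact zero_le
  calc _ ≤ ∫⁻ u : ℝ, ∫⁻ z : ℝ, (Metric.closedBall u a).indicator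
          (fun _ ↦ ENNReal.ofReal (C ^ 2 * (1 + u ^ 2)⁻¹)) z :=
        lintegral_mono fun u ↦ lintegral_mono fun z ↦ hpointwise u z
    _ = ∫⁻ u : ℝ, ENNReal.ofReal (2 * C ^ 2 * a * (1 + u ^ 2)⁻¹) := by
        refine lintegral_congr fun u ↦ ?_
        rw [lintegral_indicator_const Metric.isClosed_closedBall.measurableSet,
          Real.volume_closedBall, ← ENNReal.ofReal_mul (by positivity)]
        congr 1
        ring
    _ = ENNReal.ofReal (∫ u : ℝ, 2 * C ^ 2 * a * (1 + u ^ 2)⁻¹) :=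
        (ofReal_integral_eq_lintegral_ofReal (integrable_inv_one_add_sq.const_mul _)
          (Filter.Eventually.of_forall fun u ↦ by positivity)).symm
    _ ≤ ENNReal.ofReal (2 * C ^ 2 * Real.pi * a) := by
        rw [integral_const_mul, integral_univ_inv_one_add_sq, mul_right_comm]
end

section
/- Let n ∈ ℕ, ε > 0 and v > 0. Let x_1, …, x_n ∈ ℝ satisfy |x_i − x_j| > ε for all i ≠ j, and let z_1, …, z_n ∈ ℝ satisfy |z_i| ≤ v/2 for all i. Then for every t ∈ ℝ, the number of indices i ∈ {1, …, n} with 1_{x_i + z_i ≤ t} ≠ 1_{x_i ≤ t} is at most v/ε + 1. -/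
/-- An `ε`-separated finite family of reals in an interval of length `v` has at most `v / ε + 1`
members. -/
theorem card_le_of_separated_of_mem_Icc {ι : Type*} (s : Finset ι) (x : ι → ℝ) {ε v a : ℝ}
    (hε : 0 < ε) (hv : 0 ≤ v)
    (hsep : ∀ i ∈ s, ∀ j ∈ s, i ≠ j → ε < |x i - x j|)
    (hmem : ∀ i ∈ s, x i ∈ Set.Icc a (a + v)) :
    (s.card : ℝ) ≤ v / ε + 1 := by
  have hcard : s.card ≤ (Finset.range (⌊v / ε⌋₊ + 1)).card := by
    refine Finset.card_le_card_of_injOn (fun i => ⌊(x i - a) / ε⌋₊) ?_ ?_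
    · intro i hi
      have h := hmem i hi
      simp only [Finset.coe_range, Set.mem_Iio, Nat.lt_succ_iff]
      apply Nat.floor_le_floor
      gcongr
      linarith [h.2]
    · intro i hi j hj hij
      by_contra hne
      have hi0 : 0 ≤ (x i - a) / ε := div_nonneg (by linarith [(hmem i hi).1]) hε.le
      have hj0 : 0 ≤ (x j - a) / ε := div_nonneg (by linarith [(hmem j hj).1]) hε.le
      have hij' : (⌊(x i - a) / ε⌋₊ : ℝ) = ⌊(x j - a) / ε⌋₊ := congrArg Nat.cast hij
      have h1 := Nat.floor_le hi0
      have h2 := Nat.lt_floor_add_one ((x i - a) / ε)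
      have h3 := Nat.floor_le hj0
      have h4 := Nat.lt_floor_add_one ((x j - a) / ε)
      have hlt : |(x i - x j) / ε| < 1 := by
        have : (x i - x j) / ε = (x i - a) / ε - (x j - a) / ε := by ring
        rw [this, abs_lt]
        constructor <;> linarith
      rw [abs_div, abs_of_pos hε, div_lt_one hε] at hlt
      exact hlt.not_gt (hsep i hi j hj hne)
  rw [Finset.card_range] at hcard
  calc (s.card : ℝ) ≤ (⌊v / ε⌋₊ : ℝ) + 1 := by exact_mod_cast hcard
    _ ≤ v / ε + 1 := by
      gcongr
      exact Nat.floor_le (by positivity)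

theorem indicator_flip_count_bound
    (n : ℕ) (ε v : ℝ) (hε : 0 < ε) (hv : 0 < v)
    (x z : Fin n → ℝ)
    (hx : ∀ i j : Fin n, i ≠ j → ε < |x i - x j|)
    (hz : ∀ i : Fin n, |z i| ≤ v / 2) :
    ∀ t : ℝ,
      ((Finset.univ.filter (fun i : Fin n => ¬(x i + z i ≤ t ↔ x i ≤ t))).card : ℝ)
        ≤ v / ε + 1 := by
  intro t
  refine card_le_of_separated_of_mem_Icc _ x (a := t - v / 2) hε hv.le
    (fun i _ j _ => hx i j) ?_
  intro i hi
  have hflip := (Finset.mem_filter.mp hi).2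
  have hzi := abs_le.mp (hz i)
  by_contra hout
  rw [Set.mem_Icc, not_and_or, not_le, not_le] at hout
  apply hflip
  rcases hout with h | h
  · exact ⟨fun _ => by linarith, fun _ => by linarith [hzi.2]⟩
  · exact ⟨fun _ => by linarith [hzi.1], fun _ => by linarith⟩
end
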